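/- (Left Cluster Classification) Let n, m ≥ 1, i ∈ Fin (4^n), j ∈ Fin (4^m), and let h = B_{2m} j ⊙ I_{2n} i be the pattern bit vector (of rank 2(n+m)) of the left-cluster function g_j ⋆ f_i. Then C_{I_{2(n+m)}} · a_h = (C_{I_{2m}} · a_{B_{2m} j}) ⊗ e_i, where e_i is the i-th standard basis vector of ℝ^(4^n). In particular, the entry of C_{I_{2(n+m)}} · a_h at index z * 4^n + k is zero whenever k ≠ i, and has absolute value 2^(-m) when k = i; hence upon measurement the 2n least significant bits equal i with probability 1, identifying the promised-class component f_i. -/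

import Mathlib

/-- The product `p ⊙ q` of a pattern bit vector `p` of rank `n` with a pattern bit
vector `q` of rank `m`: `(p ⊙ q)(i * 2^m + j) = xor (p i) (q j)`. -/
def pbvProd {n m : ℕ} (p : Fin (2^n) → Bool) (q : Fin (2^m) → Bool) :
    Fin (2^(n+m)) → Bool :=
  fun k =>
    xor (p ⟨(k : ℕ) / 2^m, by
      have hk : (k : ℕ) < 2^m * 2^n :=
        lt_of_lt_of_eq k.isLt (by rw [pow_add, Nat.mul_comm])
      exact Nat.div_lt_of_lt_mul hk⟩)
      (q ⟨(k : ℕ) % 2^m, Nat.mod_lt _ (by positivity)⟩)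

/-- Two pattern bit vectors of rank `n` are orthogonal if their pointwise XOR equals
`true` at exactly `2^(n-1)` of the `2^n` indices. -/
def PBVOrthogonal {n : ℕ} (p q : Fin (2^n) → Bool) : Prop :=
  (Finset.univ.filter fun i => xor (p i) (q i) = true).card = 2^(n-1)

/-- The index `i * 2^m + j` as an element of `Fin (2^(n+m))`. -/
def finPair {n m : ℕ} (i : Fin (2^n)) (j : Fin (2^m)) : Fin (2^(n+m)) :=
  ⟨(i : ℕ) * 2^m + (j : ℕ), by
    calc (i : ℕ) * 2^m + (j : ℕ)
        < (i : ℕ) * 2^m + 2^m := Nat.add_lt_add_left j.isLt _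
      _ = ((i : ℕ) + 1) * 2^m := by ring
      _ ≤ 2^n * 2^m := Nat.mul_le_mul_right _ i.isLt
      _ = 2^(n+m) := (pow_add 2 n m).symm⟩

/-- The pattern ket of a pattern bit vector `p` of rank `n`:
`a_p i = 2^(-(n:ℝ)/2)` if `p i = false` and `a_p i = -2^(-(n:ℝ)/2)` if `p i = true`. -/
noncomputable def patternKet {n : ℕ} (p : Fin (2^n) → Bool) : Fin (2^n) → ℝ :=
  fun i => if p i then -(2 : ℝ) ^ (-(n : ℝ)/2) else (2 : ℝ) ^ (-(n : ℝ)/2)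

/-- Kronecker product of vectors: `(u ⊗ v)(i * 2^m + j) = u i * v j`. -/
noncomputable def vecKron {n m : ℕ} (u : Fin (2^n) → ℝ) (v : Fin (2^m) → ℝ) :
    Fin (2^(n+m)) → ℝ :=
  fun k =>
    u ⟨(k : ℕ) / 2^m, by
      have hk : (k : ℕ) < 2^m * 2^n :=
        lt_of_lt_of_eq k.isLt (by rw [pow_add, Nat.mul_comm])
      exact Nat.div_lt_of_lt_mul hk⟩ *
    v ⟨(k : ℕ) % 2^m, Nat.mod_lt _ (by positivity)⟩

/-- The base family `I₂`: `p_k i = decide (i = k)` for `k ∈ Fin 4`. -/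
def I2base : Fin (2^2) → Fin (2^2) → Bool := fun k i => decide (i = k)

/-- The recursively defined family `I_{2n}`:
`I_{2(n+1)} (i * 4^n + j) = p_i ⊙ I_{2n} j`. -/
def Ifam : (n : ℕ) → Fin (2^(2*n)) → Fin (2^(2*n)) → Bool
  | 0 => fun _ _ => false
  | n+1 => fun k z =>
      pbvProd (n := 2) (m := 2*n)
        (I2base ⟨(k : ℕ) / 2^(2*n), by
          have hk : (k : ℕ) < 2^(2*n) * 2^2 :=
            lt_of_lt_of_eq k.isLt
              (by rw [show 2*(n+1) = 2*n + 2 from by omega, pow_add])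
          exact Nat.div_lt_of_lt_mul hk⟩)
        (Ifam n ⟨(k : ℕ) % 2^(2*n), Nat.mod_lt _ (by positivity)⟩)
        (Fin.cast (congrArg (fun t => 2^t) (by omega : 2*(n+1) = 2 + 2*n)) z)

/-- The number of `1` bits in the binary representation of a natural number. -/
def Nat.popCount (n : ℕ) : ℕ := (Nat.bits n).count true

/-- The base family `B₂`: `e_k z = decide (Nat.popCount (k &&& z) % 2 = 1)` for `k ∈ Fin 4`. -/
def B2base : Fin (2^2) → Fin (2^2) → Bool :=
  fun k z => decide (Nat.popCount ((k : ℕ) &&& (z : ℕ)) % 2 = 1)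

/-- The recursively defined family `B_{2m}`:
`B_{2(m+1)} (i * 4^m + j) = e_i ⊙ B_{2m} j`. -/
def Bfam : (m : ℕ) → Fin (2^(2*m)) → Fin (2^(2*m)) → Bool
  | 0 => fun _ _ => false
  | m+1 => fun k z =>
      pbvProd (n := 2) (m := 2*m)
        (B2base ⟨(k : ℕ) / 2^(2*m), by
          have hk : (k : ℕ) < 2^(2*m) * 2^2 :=
            lt_of_lt_of_eq k.isLt
              (by rw [show 2*(m+1) = 2*m + 2 from by omega, pow_add])
          exact Nat.div_lt_of_lt_mul hk⟩)
        (Bfam m ⟨(k : ℕ) % 2^(2*m), Nat.mod_lt _ (by positivity)⟩)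
        (Fin.cast (congrArg (fun t => 2^t) (by omega : 2*(m+1) = 2 + 2*m)) z)

/-- The classifier matrix `C_{I₂}`: every diagonal entry is `-1/2`,
every off-diagonal entry is `1/2`. -/
noncomputable def CI2 : Matrix (Fin 4) (Fin 4) ℝ :=
  Matrix.of fun i j => if i = j then -(1/2 : ℝ) else 1/2

/-- Kronecker product of square matrices:
`(A ⊗ B)(i * M + j)(i' * M + j') = A i i' * B j j'`. -/
noncomputable def matKron {N M : ℕ} (A : Matrix (Fin N) (Fin N) ℝ)
    (B : Matrix (Fin M) (Fin M) ℝ) : Matrix (Fin (N*M)) (Fin (N*M)) ℝ :=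
  Matrix.of fun i j => A i.divNat j.divNat * B i.modNat j.modNat

/-- The `n`-fold Kronecker power `C_{I_{2n}}`, defined recursively by
`C_{I_{2(n+1)}} = C_{I₂} ⊗ C_{I_{2n}}`. -/
noncomputable def CIpow : (n : ℕ) → Matrix (Fin (2^(2*n))) (Fin (2^(2*n))) ℝ
  | 0 => 1
  | n+1 =>
      Matrix.of fun i j =>
        matKron CI2 (CIpow n)
          (Fin.cast (by rw [show 2*(n+1) = 2 + 2*n from by omega, pow_add]; norm_num) i)
          (Fin.cast (by rw [show 2*(n+1) = 2 + 2*n from by omega, pow_add]; norm_num) j)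

/-- Transport a pattern bit vector along an equality of ranks. -/
def pbvCast {a b : ℕ} (h : a = b) (p : Fin (2^a) → Bool) : Fin (2^b) → Bool :=
  fun z => p (Fin.cast (congrArg (fun t => 2^t) h.symm) z)

/-- Transport a real vector along an equality of ranks. -/
noncomputable def vecCast {a b : ℕ} (h : a = b) (u : Fin (2^a) → ℝ) : Fin (2^b) → ℝ :=
  fun z => u (Fin.cast (congrArg (fun t => 2^t) h.symm) z)

/-- The entries of `CIpow`, indexed by natural numbers. -/
noncomputable def ciEntry : ℕ → ℕ → ℕ → ℝ
  | 0 => fun _ _ => 1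
  | n+1 => fun a b =>
      (if a / 2^(2*n) = b / 2^(2*n) then -(1/2 : ℝ) else 1/2) *
        ciEntry n (a % 2^(2*n)) (b % 2^(2*n))

theorem CIpow_apply (n : ℕ) (i j : Fin (2^(2*n))) :
    CIpow n i j = ciEntry n i j := by
  induction n with
  | zero =>
    obtain rfl : i = j := Subsingleton.elim (α := Fin 1) i j
    simp [CIpow, ciEntry]
  | succ n ih =>
    simp only [CIpow, ciEntry, matKron, Matrix.of_apply, ih, CI2, Fin.ext_iff, Fin.coe_divNat,
      Fin.coe_modNat, Fin.val_cast]
    rfl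

theorem ciEntry_add (m n a b : ℕ) (ha : a < 2^(2*(m+n))) (hb : b < 2^(2*(m+n))) :
    ciEntry (m+n) a b =
      ciEntry m (a / 2^(2*n)) (b / 2^(2*n)) * ciEntry n (a % 2^(2*n)) (b % 2^(2*n)) := by
  induction m generalizing a b with
  | zero =>
    rw [zero_add] at ha hb
    simp [ciEntry, Nat.mod_eq_of_lt ha, Nat.mod_eq_of_lt hb]
  | succ m ih =>
    have hpow : 2^(2*(m+n)) = 2^(2*n) * 2^(2*m) := by rw [← pow_add]; congr 1; ring
    have hmod (x : ℕ) : x % 2^(2*(m+n)) / 2^(2*n) = x / 2^(2*n) % 2^(2*m) := by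
      rw [hpow, Nat.mod_mul_right_div_self]
    have hmod' (x : ℕ) : x % 2^(2*(m+n)) % 2^(2*n) = x % 2^(2*n) := by
      rw [hpow, Nat.mod_mul_right_mod]
    have hdiv (x : ℕ) : x / 2^(2*(m+n)) = x / 2^(2*n) / 2^(2*m) := by
      rw [hpow, Nat.div_div_eq_div_mul]
    rw [Nat.add_right_comm]
    simp only [ciEntry]
    rw [ih _ _ (Nat.mod_lt _ (by positivity)) (Nat.mod_lt _ (by positivity))]
    simp only [hmod, hmod', hdiv, mul_assoc]

/-- The index equivalence underlying `vecKron`. -/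
def kronIndexEquiv {a b c : ℕ} (h : a + b = c) : Fin (2^c) ≃ Fin (2^a) × Fin (2^b) :=
  (finCongr (by rw [← h, pow_add])).trans finProdFinEquiv.symm

theorem CIpow_mulVec_vecKron {m n N : ℕ} (h : 2*m + 2*n = 2*N)
    (u : Fin (2^(2*m)) → ℝ) (v : Fin (2^(2*n)) → ℝ) :
    (CIpow N).mulVec (vecCast h (vecKron u v)) =
      vecCast h (vecKron ((CIpow m).mulVec u) ((CIpow n).mulVec v)) := by
  obtain rfl : N = m + n := by omega
  ext z
  simp only [Matrix.mulVec, dotProduct, vecCast, vecKron, Finset.sum_mul_sum]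
  rw [← Fintype.sum_prod_type']
  refine Fintype.sum_equiv (kronIndexEquiv h) _ _ fun y => ?_
  rw [CIpow_apply, CIpow_apply, CIpow_apply, ciEntry_add m n z y z.isLt y.isLt]
  exact mul_mul_mul_comm _ _ _ _

theorem patternKet_pbvCast_pbvProd {a b c : ℕ} (h : a + b = c)
    (p : Fin (2^a) → Bool) (q : Fin (2^b) → Bool) :
    patternKet (pbvCast h (pbvProd p q)) =
      vecCast h (vecKron (patternKet p) (patternKet q)) := by
  subst h
  ext z
  have hpow : (2 : ℝ) ^ (-((a + b : ℕ) : ℝ)/2) =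
      (2 : ℝ) ^ (-(a : ℝ)/2) * (2 : ℝ) ^ (-(b : ℝ)/2) := by
    rw [← Real.rpow_add two_pos]
    congr 1
    push_cast
    ring
  simp only [patternKet, pbvCast, pbvProd, vecCast, vecKron, hpow]
  generalize p _ = x
  generalize q _ = y
  cases x <;> cases y <;> simp

theorem CIpow_one_mulVec (p : Fin 4 → Bool) (z : Fin 4) :
    (CIpow 1).mulVec (patternKet (n := 2) p) z =
      ∑ y : Fin 4, (if z = y then -(1/2 : ℝ) else 1/2) * (if p y then -(1/2) else 1/2) := by
  have hpow : (2 : ℝ) ^ (-((2 : ℕ) : ℝ)/2) = 1/2 := by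
    rw [show -((2 : ℕ) : ℝ)/2 = -1 by norm_num, Real.rpow_neg_one]
    norm_num
  change ∑ y : Fin 4, CIpow 1 z y * patternKet (n := 2) p y = _
  refine Finset.sum_congr rfl fun y _ => ?_
  rw [CIpow_apply (n := 1)]
  simp only [patternKet, hpow, ciEntry, Fin.ext_iff, mul_zero, pow_zero, Nat.div_one, mul_one]

theorem CIpow_one_mulVec_I2base (k z : Fin (2^2)) :
    (CIpow 1).mulVec (patternKet (I2base k)) z = if z = k then 1 else 0 := by
  change Fin 4 at k z
  refine (CIpow_one_mulVec (I2base k) z).trans ?_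
  fin_cases k <;> fin_cases z <;> simp [Fin.sum_univ_four, I2base] <;> norm_num

theorem abs_CIpow_one_mulVec_B2base (k z : Fin (2^2)) :
    |(CIpow 1).mulVec (patternKet (B2base k)) z| = 1/2 := by
  change Fin 4 at k z
  rw [show (CIpow 1).mulVec (patternKet (B2base k)) z = _ from CIpow_one_mulVec (B2base k) z]
  have bits_two : Nat.bits 2 = [false, true] := by simpa using Nat.bit0_bits 1 one_ne_zero
  have bits_three : Nat.bits 3 = [true, true] := by simpa using Nat.bit1_bits 1
  have hB : B2base = ![![false, false, false, false], ![false, true, false, true],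
      ![false, false, true, true], ![false, true, true, false]] := by
    funext k z
    change Fin 4 at k z
    fin_cases k <;> fin_cases z <;> simp [B2base, Nat.popCount, bits_two, bits_three]
  rw [hB]
  fin_cases k <;> fin_cases z <;> simp [Fin.sum_univ_four] <;> norm_num [abs_of_pos, abs_of_neg]

theorem CIpow_mulVec_Ifam (n : ℕ) (i : Fin (2^(2*n))) :
    (CIpow n).mulVec (patternKet (Ifam n i)) = fun k => if k = i then 1 else 0 := by
  induction n with
  | zero =>
    ext k
    have : k = i := Subsingleton.elim (α := Fin 1) k i
    simp [CIpow, patternKet, Ifam, this]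
  | succ n ih =>
    have hrank : 2 + 2*n = 2*(n+1) := by omega
    change (CIpow (n+1)).mulVec (patternKet (pbvCast hrank (pbvProd (n := 2) _ _))) = _
    rw [patternKet_pbvCast_pbvProd]
    refine (CIpow_mulVec_vecKron (m := 1) hrank _ _).trans ?_
    rw [ih]
    ext k
    simp only [vecCast, vecKron]
    refine (congrArg (· * _) (CIpow_one_mulVec_I2base _ _)).trans ?_
    simp only [Fin.ext_iff, Fin.val_cast, ← ite_and, mul_ite, mul_one, mul_zero]
    refine if_congr ⟨fun ⟨h₁, h₂⟩ => ?_, fun h => by simp [h]⟩ rfl rfl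
    rw [← Nat.div_add_mod k (2^(2*n)), ← Nat.div_add_mod i (2^(2*n)), h₁, h₂]

theorem abs_CIpow_mulVec_Bfam (m : ℕ) (j z : Fin (2^(2*m))) :
    |(CIpow m).mulVec (patternKet (Bfam m j)) z| = ((2 : ℝ)^m)⁻¹ := by
  induction m with
  | zero => simp [CIpow, patternKet, Bfam]
  | succ m ih =>
    have hrank : 2 + 2*m = 2*(m+1) := by omega
    change |(CIpow (m+1)).mulVec (patternKet (pbvCast hrank (pbvProd (n := 2) _ _))) z| = _
    rw [patternKet_pbvCast_pbvProd]
    refine (congrArg (fun w => |w z|) (CIpow_mulVec_vecKron (m := 1) hrank _ _)).trans ?_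
    simp only [vecCast, vecKron, abs_mul, ih]
    refine (congrArg (· * _) (abs_CIpow_one_mulVec_B2base _ _)).trans ?_
    rw [pow_succ, mul_inv, mul_comm, one_div]

theorem vecCast_vecKron_finPair {a b c : ℕ} (h : a + b = c)
    (u : Fin (2^a) → ℝ) (v : Fin (2^b) → ℝ) (z : Fin (2^a)) (k : Fin (2^b)) :
    vecCast h (vecKron u v) (Fin.cast (congrArg (fun t => 2^t) h) (finPair z k)) =
      u z * v k := by
  have hdiv : ((z : ℕ) * 2^b + k) / 2^b = z := by
    rw [mul_comm, Nat.mul_add_div (by positivity), Nat.div_eq_of_lt k.isLt, add_zero]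
  have hmod : ((z : ℕ) * 2^b + k) % 2^b = k := by
    rw [mul_comm, Nat.mul_add_mod, Nat.mod_eq_of_lt k.isLt]
  simp only [vecCast, vecKron, finPair, Fin.val_cast, hdiv, hmod, Fin.eta]

/-- **Left Cluster Classification.** Let `h = B_{2m} j ⊙ I_{2n} i` be the
pattern bit vector (of rank `2(n+m)`) of the left-cluster function `g_j ⋆ f_i`. Then
`C_{I_{2(n+m)}} · a_h = (C_{I_{2m}} · a_{B_{2m} j}) ⊗ e_i`; in particular the entry at
index `z * 4^n + k` vanishes for `k ≠ i` and has absolute value `2^(-m)` for `k = i`,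
so measurement identifies the promised-class component `f_i` with probability 1. -/
theorem left_cluster_classification (n m : ℕ) (hn : 1 ≤ n) (hm : 1 ≤ m)
    (i : Fin (2^(2*n))) (j : Fin (2^(2*m)))
    (h : Fin (2^(2*(n+m))) → Bool)
    (hh : h = pbvCast (by omega : 2*m + 2*n = 2*(n+m)) (pbvProd (Bfam m j) (Ifam n i)))
    (v : Fin (2^(2*(n+m))) → ℝ)
    (hv : v = (CIpow (n+m)).mulVec (patternKet h)) :
    v = vecCast (by omega : 2*m + 2*n = 2*(n+m))
          (vecKron ((CIpow m).mulVec (patternKet (Bfam m j)))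
            (fun k => if k = i then (1 : ℝ) else 0)) ∧
    (∀ (z : Fin (2^(2*m))) (k : Fin (2^(2*n))), k ≠ i →
      v (Fin.cast (congrArg (fun t => 2^t) (by omega : 2*m + 2*n = 2*(n+m)))
          (finPair z k)) = 0) ∧
    (∀ z : Fin (2^(2*m)),
      |v (Fin.cast (congrArg (fun t => 2^t) (by omega : 2*m + 2*n = 2*(n+m)))
          (finPair z i))| = ((2 : ℝ)^m)⁻¹) := by
  have hrank : 2*m + 2*n = 2*(n+m) := by omega
  have key : v = vecCast hrank (vecKron ((CIpow m).mulVec (patternKet (Bfam m j)))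
      (fun k => if k = i then (1 : ℝ) else 0)) := by
    rw [hv, hh, patternKet_pbvCast_pbvProd, CIpow_mulVec_vecKron, CIpow_mulVec_Ifam]
  refine ⟨key, fun z k hk => ?_, fun z => ?_⟩
  · rw [key, vecCast_vecKron_finPair, if_neg hk, mul_zero]
  · rw [key, vecCast_vecKron_finPair, if_pos rfl, mul_one, abs_CIpow_mulVec_Bfam]
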